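/- (Theorem 3.27) If the presentation Γ,Δ ⊢ is derivable in the unpolarized sequent calculus for LG∅, then for every Π ∈ τ*(⌊Γ⌋⁺) and every Σ ∈ τ*(⌊Δ⌋⁺), the focused presentation Π,Σ ⊢ is derivable (with the parameter set X instantiated to {⌊Γ⌋⁻, ⌊Δ⌋⁻}). -/

import Mathlib

/-- Unpolarized formulas of LG/CNL.  `ldiv B A` denotes `B\A`, `lsub B A` denotes `B⦸A`,
`rdiv A B` denotes `A/B`, `rsub A B` denotes `A⊘B`. -/
inductive Fm : Type
  | pos : Nat → Fm                -- positive atom p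
  | neg : Nat → Fm                -- negative atom p̄
  | tens : Fm → Fm → Fm           -- A ⊗ B
  | par : Fm → Fm → Fm            -- A ⊕ B
  | rdiv : Fm → Fm → Fm           -- A / B
  | ldiv : Fm → Fm → Fm           -- B \ A  (ldiv B A)
  | rsub : Fm → Fm → Fm           -- A ⊘ B
  | lsub : Fm → Fm → Fm           -- B ⦸ A  (lsub B A)
  | conj : Fm → Fm → Fm           -- A ∧ B
  | disj : Fm → Fm → Fm           -- A ∨ B

/-- Linear negation. -/
def Fm.dual : Fm → Fm
  | .pos n => .neg n
  | .neg n => .pos n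
  | .tens A B => .par B.dual A.dual        -- (A⊗B)⊥ = B⊥⊕A⊥
  | .par A B => .tens B.dual A.dual        -- (A⊕B)⊥ = B⊥⊗A⊥
  | .rdiv A B => .lsub B.dual A.dual       -- (A/B)⊥ = B⊥⦸A⊥
  | .lsub B A => .rdiv A.dual B.dual       -- (B⦸A)⊥ = A⊥/B⊥
  | .ldiv B A => .rsub A.dual B.dual       -- (B\A)⊥ = A⊥⊘B⊥
  | .rsub A B => .ldiv B.dual A.dual       -- (A⊘B)⊥ = B⊥\A⊥
  | .conj A B => .disj B.dual A.dual       -- (A∧B)⊥ = B⊥∨A⊥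
  | .disj A B => .conj B.dual A.dual       -- (A∨B)⊥ = B⊥∧A⊥
/-- Structures: Γ ::= A | Γ·⊗·Δ | Γ·⊘·Δ | Δ·⦸·Γ.
`slsub Δ Γ` denotes `Δ·⦸·Γ`, `srsub Γ Δ` denotes `Γ·⊘·Δ`. -/
inductive Str : Type
  | fm : Fm → Str
  | stens : Str → Str → Str
  | srsub : Str → Str → Str
  | slsub : Str → Str → Str

mutual
/-- The positive formula interpretation Γ⁺ of a structure. -/
def Str.posF : Str → Fm
  | .fm A => A
  | .stens Γ Δ => .tens Γ.posF Δ.posF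
  | .srsub Γ Δ => .rsub Γ.posF Δ.negF
  | .slsub Δ Γ => .lsub Δ.negF Γ.posF
/-- The negative formula interpretation Γ⁻ of a structure. -/
def Str.negF : Str → Fm
  | .fm A => A.dual
  | .stens Γ Δ => .par Δ.negF Γ.negF
  | .srsub Γ Δ => .ldiv Δ.posF Γ.negF
  | .slsub Δ Γ => .rdiv Γ.negF Δ.posF
end

/-- One-sided sequent derivability `DSeq g c Γ Δ` of the presentation `Γ,Δ ⊢`.
The flag `g` enables the Grishin (linear distributivity) structural rules of LG_I,
the flag `c` enables the CNL structural rules.  Thus `DSeq false false` is LG∅,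
`DSeq true false` is LG_I, and `DSeq false true` is CNL. -/
inductive DSeq : Bool → Bool → Str → Str → Prop
  | ax {g c A} : DSeq g c (.fm A) (.fm A.dual)
  | cut {g c Γ Δ A} : DSeq g c Δ (.fm A) → DSeq g c Γ (.fm A.dual) → DSeq g c Γ Δ
  | sym {g c Γ Δ} : DSeq g c Γ Δ → DSeq g c Δ Γ
  | dp1 {g c Γ Δ Θ} : DSeq g c (.stens Γ Δ) Θ → DSeq g c Γ (.slsub Δ Θ)
  | dp1' {g c Γ Δ Θ} : DSeq g c Γ (.slsub Δ Θ) → DSeq g c (.stens Γ Δ) Θ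
  | dp2 {g c Γ Δ Θ} : DSeq g c Γ (.stens Δ Θ) → DSeq g c (.srsub Γ Δ) Θ
  | dp2' {g c Γ Δ Θ} : DSeq g c (.srsub Γ Δ) Θ → DSeq g c Γ (.stens Δ Θ)
  | tensL {g c Γ A B} : DSeq g c Γ (.stens (.fm A) (.fm B)) → DSeq g c Γ (.fm (.tens A B))
  | lsubL {g c Γ A B} : DSeq g c Γ (.slsub (.fm B.dual) (.fm A)) → DSeq g c Γ (.fm (.lsub B A))
  | rsubL {g c Γ A B} : DSeq g c Γ (.srsub (.fm A) (.fm B.dual)) → DSeq g c Γ (.fm (.rsub A B))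
  | parL {g c Γ Δ A B} : DSeq g c Γ (.fm A) → DSeq g c Δ (.fm B) →
      DSeq g c (.stens Δ Γ) (.fm (.par A B))
  | rdivL {g c Γ Δ A B} : DSeq g c Δ (.fm B.dual) → DSeq g c Γ (.fm A) →
      DSeq g c (.slsub Δ Γ) (.fm (.rdiv A B))
  | ldivL {g c Γ Δ A B} : DSeq g c Δ (.fm B.dual) → DSeq g c Γ (.fm A) →
      DSeq g c (.srsub Γ Δ) (.fm (.ldiv B A))
  | conjL1 {g c Γ A B} : DSeq g c Γ (.fm A) → DSeq g c Γ (.fm (.conj A B))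
  | conjL2 {g c Γ A B} : DSeq g c Γ (.fm B) → DSeq g c Γ (.fm (.conj A B))
  | disjL {g c Γ A B} : DSeq g c Γ (.fm A) → DSeq g c Γ (.fm B) → DSeq g c Γ (.fm (.disj A B))
  -- Grishin structural rules (LG_I)
  | gr1 {c Γ₁ Γ₂ Δ₁ Δ₂} : DSeq true c (.srsub Γ₂ Δ₂) (.srsub Δ₁ Γ₁) →
      DSeq true c (.stens Γ₁ Γ₂) (.stens Δ₂ Δ₁)
  | gr2 {c Γ₁ Γ₂ Δ₁ Δ₂} : DSeq true c (.slsub Δ₁ Γ₁) (.slsub Γ₂ Δ₂) →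
      DSeq true c (.stens Γ₁ Γ₂) (.stens Δ₂ Δ₁)
  | gr3 {c Γ₁ Γ₂ Δ₁ Δ₂} : DSeq true c (.srsub Δ₂ Γ₁) (.slsub Δ₁ Γ₂) →
      DSeq true c (.stens Γ₁ Γ₂) (.stens Δ₂ Δ₁)
  -- CNL structural rules
  | cnl1 {g Γ Δ Θ} : DSeq g true Γ (.srsub Δ Θ) → DSeq g true Γ (.stens Δ Θ)
  | cnl1' {g Γ Δ Θ} : DSeq g true Γ (.stens Δ Θ) → DSeq g true Γ (.srsub Δ Θ)
  | cnl2 {g Γ Δ Θ} : DSeq g true Γ (.slsub Δ Θ) → DSeq g true Γ (.stens Δ Θ)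
  | cnl2' {g Γ Δ Θ} : DSeq g true Γ (.stens Δ Θ) → DSeq g true Γ (.slsub Δ Θ)
mutual
/-- Positive polarized formulas.  `rsub P N` denotes `P⊘N`, `lsub N P` denotes `N⦸P`. -/
inductive PFm : Type
  | pos : Nat → PFm               -- atom p
  | tens : PFm → PFm → PFm        -- P ⊗ Q
  | rsub : PFm → NFm → PFm        -- P ⊘ N
  | lsub : NFm → PFm → PFm        -- N ⦸ P
  | disj : PFm → PFm → PFm        -- P ∨ Q
  | down : NFm → PFm              -- ↓N
/-- Negative polarized formulas.  `rdiv M Q` denotes `M/Q`, `ldiv Q M` denotes `Q\M`. -/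
inductive NFm : Type
  | neg : Nat → NFm               -- atom p̄
  | par : NFm → NFm → NFm         -- M ⊕ N
  | ldiv : PFm → NFm → NFm        -- Q \ M
  | rdiv : NFm → PFm → NFm        -- M / Q
  | conj : NFm → NFm → NFm        -- M ∧ N
  | up : PFm → NFm                -- ↑P
end

mutual
/-- Polarized linear negation (positive to negative). -/
def PFm.dual : PFm → NFm
  | .pos n => .neg n
  | .tens P Q => .par Q.dual P.dual        -- (P⊗Q)⊥ = Q⊥⊕P⊥
  | .rsub P N => .ldiv N.dual P.dual       -- (P⊘N)⊥ = N⊥\P⊥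
  | .lsub N P => .rdiv P.dual N.dual       -- (N⦸P)⊥ = P⊥/N⊥
  | .disj P Q => .conj Q.dual P.dual       -- (P∨Q)⊥ = Q⊥∧P⊥
  | .down N => .up N.dual                  -- (↓N)⊥ = ↑(N⊥)
/-- Polarized linear negation (negative to positive). -/
def NFm.dual : NFm → PFm
  | .neg n => .pos n
  | .par M N => .tens N.dual M.dual        -- (M⊕N)⊥ = N⊥⊗M⊥
  | .ldiv Q M => .rsub M.dual Q.dual       -- (Q\M)⊥ = M⊥⊘Q⊥
  | .rdiv M Q => .lsub Q.dual M.dual       -- (M/Q)⊥ = Q⊥⦸M⊥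
  | .conj M N => .disj N.dual M.dual       -- (M∧N)⊥ = N⊥∨M⊥
  | .up P => .down P.dual                  -- (↑P)⊥ = ↓(P⊥)
end
/-- The polarity ε of an unpolarized formula: `true` (positive) for `p`, `⊗`, `⊘`, `⦸`
(and the additive disjunction `∨`, which decorates to a positive polarized formula),
`false` (negative) otherwise. -/
def Fm.eps : Fm → Bool
  | .pos _ => true
  | .tens _ _ => true
  | .rsub _ _ => true
  | .lsub _ _ => true
  | .disj _ _ => true
  | _ => false

mutual
/-- `decP A` is `A'`: the shift decoration `⌊A⌋` if `ε(A)=+`, and `↓⌊A⌋` if `ε(A)=−`.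
In particular, for positive `A`, `⌊A⌋ = decP A`. -/
def decP : Fm → PFm
  | .pos n => .pos n
  | .neg n => .down (.neg n)
  | .tens A B => .tens (decP A) (decP B)           -- ⌊A⊗B⌋ = A'⊗B'
  | .rsub A B => .rsub (decP A) (decN B)           -- ⌊A⊘B⌋ = A'⊘B''
  | .lsub B A => .lsub (decN B) (decP A)           -- ⌊B⦸A⌋ = B''⦸A'
  | .disj A B => .disj (decP A) (decP B)           -- ⌊A∨B⌋ = A'∨B'
  | .par A B => .down (.par (decN A) (decN B))     -- ⌊A⊕B⌋ = A''⊕B''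
  | .ldiv B A => .down (.ldiv (decP B) (decN A))   -- ⌊B\A⌋ = B'\A''
  | .rdiv A B => .down (.rdiv (decN A) (decP B))   -- ⌊A/B⌋ = A''/B'
  | .conj A B => .down (.conj (decN A) (decN B))   -- ⌊A∧B⌋ = A''∧B''
/-- `decN A` is `A''`: the shift decoration `⌊A⌋` if `ε(A)=−`, and `↑⌊A⌋` if `ε(A)=+`.
In particular, for negative `A`, `⌊A⌋ = decN A`. -/
def decN : Fm → NFm
  | .pos n => .up (.pos n)
  | .neg n => .neg n
  | .tens A B => .up (.tens (decP A) (decP B))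
  | .rsub A B => .up (.rsub (decP A) (decN B))
  | .lsub B A => .up (.lsub (decN B) (decP A))
  | .disj A B => .up (.disj (decP A) (decP B))
  | .par A B => .par (decN A) (decN B)
  | .ldiv B A => .ldiv (decP B) (decN A)
  | .rdiv A B => .rdiv (decN A) (decP B)
  | .conj A B => .conj (decN A) (decN B)
end
/-- Polarized structures, containing only positive formulas.
`slsub Δ Γ` denotes `Δ·⦸·Γ`, `srsub Γ Δ` denotes `Γ·⊘·Δ`. -/
inductive PStr : Type
  | fm : PFm → PStr
  | stens : PStr → PStr → PStr
  | srsub : PStr → PStr → PStr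
  | slsub : PStr → PStr → PStr

mutual
/-- The positive formula interpretation Γ⁺ of a polarized structure. -/
def PStr.posF : PStr → PFm
  | .fm P => P
  | .stens Γ Δ => .tens Γ.posF Δ.posF
  | .srsub Γ Δ => .rsub Γ.posF Δ.negF
  | .slsub Δ Γ => .lsub Δ.negF Γ.posF
/-- The negative formula interpretation Γ⁻ of a polarized structure. -/
def PStr.negF : PStr → NFm
  | .fm P => P.dual
  | .stens Γ Δ => .par Δ.negF Γ.negF
  | .srsub Γ Δ => .ldiv Δ.posF Γ.negF
  | .slsub Δ Γ => .rdiv Γ.negF Δ.posF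
end
/-- The shift decoration on structures: each formula occurrence `A` is replaced by `A'`
(i.e. `⌊A⌋` if `ε(A)=+`, and `↓⌊A⌋` if `ε(A)=−`). -/
def decS : Str → PStr
  | .fm A => .fm (decP A)
  | .stens Γ Δ => .stens (decS Γ) (decS Δ)
  | .srsub Γ Δ => .srsub (decS Γ) (decS Δ)
  | .slsub Δ Γ => .slsub (decS Δ) (decS Γ)
/-- A polarized formula: either positive or negative. -/
abbrev Pol : Type := PFm ⊕ NFm

mutual
/-- The subformula map σ on negative polarized formulas. -/
def ssig : NFm → Set Pol
  | .up P => insert (Sum.inr P.dual) (ttau P)       -- σ(↑P) = {P⊥} ∪ τ(P)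
  | .neg n => {Sum.inr (.neg n)}
  | .conj M N => ssig M ∪ ssig N
  | .par M N => ssig M ∪ ssig N
  | .rdiv M Q => ssig M ∪ ttau Q
  | .ldiv Q M => ssig M ∪ ttau Q
/-- The subformula map τ on positive polarized formulas. -/
def ttau : PFm → Set Pol
  | .down N => insert (Sum.inr N) (ssig N)          -- τ(↓N) = {N} ∪ σ(N)
  | .pos n => {Sum.inl (.pos n)}
  | .disj P Q => ttau P ∪ ttau Q
  | .tens P Q => ttau P ∪ ttau Q
  | .lsub N P => ttau P ∪ ssig N
  | .rsub P N => ttau P ∪ ssig N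
end

/-- The closure X^τ = ⋃ { τ(↓N) | N ∈ X } of a set X of negative formulas. -/
def Xtau (X : Set NFm) : Set Pol := {a | ∃ N ∈ X, a ∈ ttau (.down N)}
/-- Focused structures: π ::= p | N | π·⊗·σ | π·⊘·σ | σ·⦸·π, where a negative formula `N`
stands for its implicit ↓-shift.  `slsub σ π` denotes `σ·⦸·π`, `srsub π σ` denotes `π·⊘·σ`. -/
inductive FStr : Type
  | at : Nat → FStr
  | nfm : NFm → FStr
  | stens : FStr → FStr → FStr
  | srsub : FStr → FStr → FStr
  | slsub : FStr → FStr → FStr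

/-- The decomposition relation `Tstar P σ`, i.e. `σ ∈ τ*(P)`:
τ*(P⊗Q)={π·⊗·σ | π∈τ*(P), σ∈τ*(Q)}, τ*(P⊘N)={π·⊘·σ | π∈τ*(P), σ∈τ*(N⊥)},
τ*(N⦸P)={σ·⦸·π | π∈τ*(P), σ∈τ*(N⊥)}, τ*(P∨Q)=τ*(P)∪τ*(Q), τ*(p)={p}, τ*(↓N)={N}. -/
inductive Tstar : PFm → FStr → Prop
  | tens {P Q π σ} : Tstar P π → Tstar Q σ → Tstar (.tens P Q) (.stens π σ)
  | rsub {P N π σ} : Tstar P π → Tstar N.dual σ → Tstar (.rsub P N) (.srsub π σ)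
  | lsub {N P π σ} : Tstar P π → Tstar N.dual σ → Tstar (.lsub N P) (.slsub σ π)
  | disjl {P Q π} : Tstar P π → Tstar (.disj P Q) π
  | disjr {P Q π} : Tstar Q π → Tstar (.disj P Q) π
  | at {n} : Tstar (.pos n) (.at n)
  | down {N} : Tstar (.down N) (.nfm N)
/-- One-hole contexts over focused structures. -/
inductive FCtx : Type
  | hole : FCtx
  | tensL : FCtx → FStr → FCtx      -- π[]·⊗·σ
  | tensR : FStr → FCtx → FCtx      -- π·⊗·σ[]
  | rsubL : FCtx → FStr → FCtx      -- π[]·⊘·σ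
  | rsubR : FStr → FCtx → FCtx      -- π·⊘·σ[]
  | lsubL : FCtx → FStr → FCtx      -- σ[]·⦸·π
  | lsubR : FStr → FCtx → FCtx      -- σ·⦸·π[]

/-- Substitution `π[υ]` of a structure for the hole of a context. -/
def FCtx.fill : FCtx → FStr → FStr
  | .hole, υ => υ
  | .tensL c σ, υ => .stens (c.fill υ) σ
  | .tensR π c, υ => .stens π (c.fill υ)
  | .rsubL c σ, υ => .srsub (c.fill υ) σ
  | .rsubR π c, υ => .srsub π (c.fill υ)
  | .lsubL c π, υ => .slsub (c.fill υ) π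
  | .lsubR σ c, υ => .slsub σ (c.fill υ)

/-- The display map `π[] ÷ υ`. -/
def FCtx.div : FCtx → FStr → FStr
  | .hole, υ => υ
  | .tensL c σ, υ => c.div (.slsub σ υ)       -- (π[]·⊗·σ)÷υ = π[]÷(σ·⦸·υ)
  | .tensR π c, υ => c.div (.srsub υ π)       -- (π·⊗·σ[])÷υ = σ[]÷(υ·⊘·π)
  | .rsubL c σ, υ => c.div (.stens σ υ)       -- (π[]·⊘·σ)÷υ = π[]÷(σ·⊗·υ)
  | .rsubR π c, υ => c.div (.slsub υ π)       -- (π·⊘·σ[])÷υ = σ[]÷(υ·⦸·π)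
  | .lsubR σ c, υ => c.div (.stens υ σ)       -- (σ·⦸·π[])÷υ = π[]÷(υ·⊗·σ)
  | .lsubL c π, υ => c.div (.srsub π υ)       -- (σ[]·⦸·π)÷υ = σ[]÷(π·⊘·υ)
mutual
/-- Strongly focused derivability of presentations `π,σ ⊢`, relative to the parameter
set `X` of negative formulas.  The rule (D) covers both presentation contexts
`ω[] = ⟨π[],σ⟩` and `ω[] = ⟨σ,π[]⟩`, with `ω*[] = π[]÷σ`. -/
inductive FSeq (X : Set NFm) : FStr → FStr → Prop
  | decL {N σ'} (c : FCtx) (υ : FStr) : Sum.inr N ∈ Xtau X → Tstar N.dual σ' →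
      FFoc X (c.div υ) σ' → FSeq X (c.fill (.nfm N)) υ
  | decR {N σ'} (c : FCtx) (υ : FStr) : Sum.inr N ∈ Xtau X → Tstar N.dual σ' →
      FFoc X (c.div υ) σ' → FSeq X υ (c.fill (.nfm N))
/-- Strongly focused derivability `π ⊢f σ` (context splitting judgement). -/
inductive FFoc (X : Set NFm) : FStr → FStr → Prop
  | id {n} : FFoc X (.at n) (.at n)
  | react {π N} : (∀ σ, Tstar N.dual σ → FSeq X π σ) → FFoc X π (.nfm N)
  | tens {π π' σ σ'} : FFoc X π π' → FFoc X σ σ' → FFoc X (.stens π σ) (.stens π' σ')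
  | rsub {π π' σ σ'} : FFoc X σ σ' → FFoc X π π' → FFoc X (.srsub π σ) (.srsub π' σ')
  | lsub {π π' σ σ'} : FFoc X σ σ' → FFoc X π π' → FFoc X (.slsub σ π) (.slsub σ' π')
end


namespace FocProof

mutual
theorem dualP : ∀ P : PFm, P.dual.dual = P
  | .pos n => by simp [PFm.dual, NFm.dual]
  | .tens P Q => by simp [PFm.dual, NFm.dual, dualP P, dualP Q]
  | .rsub P N => by simp [PFm.dual, NFm.dual, dualP P, dualN N]
  | .lsub N P => by simp [PFm.dual, NFm.dual, dualP P, dualN N]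
  | .disj P Q => by simp [PFm.dual, NFm.dual, dualP P, dualP Q]
  | .down N => by simp [PFm.dual, NFm.dual, dualN N]
theorem dualN : ∀ N : NFm, N.dual.dual = N
  | .neg n => by simp [PFm.dual, NFm.dual]
  | .par M N => by simp [PFm.dual, NFm.dual, dualN M, dualN N]
  | .ldiv Q M => by simp [PFm.dual, NFm.dual, dualN M, dualP Q]
  | .rdiv M Q => by simp [PFm.dual, NFm.dual, dualN M, dualP Q]
  | .conj M N => by simp [PFm.dual, NFm.dual, dualN M, dualN N]
  | .up P => by simp [PFm.dual, NFm.dual, dualP P]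
end

theorem dualF (A : Fm) : A.dual.dual = A := by
  induction A <;> simp_all [Fm.dual]

theorem dec_dual (A : Fm) : (decP A).dual = decN A.dual ∧ (decN A).dual = decP A.dual := by
  induction A <;> simp_all [Fm.dual, decP, decN, PFm.dual, NFm.dual]

theorem negF_dual (Γ : PStr) : Γ.posF.dual = Γ.negF ∧ Γ.negF.dual = Γ.posF := by
  induction Γ <;> simp_all [PStr.posF, PStr.negF, PFm.dual, NFm.dual, dualP]

mutual
def szP : PFm → Nat
  | .pos _ => 1
  | .tens P Q => szP P + szP Q + 1
  | .rsub P N => szP P + szN N + 1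
  | .lsub N P => szP P + szN N + 1
  | .disj P Q => szP P + szP Q + 1
  | .down N => szN N + 1
def szN : NFm → Nat
  | .neg _ => 1
  | .par M N => szN M + szN N + 1
  | .ldiv Q M => szN M + szP Q + 1
  | .rdiv M Q => szN M + szP Q + 1
  | .conj M N => szN M + szN N + 1
  | .up P => szP P + 1
end

mutual
theorem sz_dualP : ∀ P : PFm, szN P.dual = szP P
  | .pos n => by simp [PFm.dual, szP, szN]
  | .tens P Q => by simp [PFm.dual, szP, szN, sz_dualP P, sz_dualP Q]; omega
  | .rsub P N => by simp [PFm.dual, szP, szN, sz_dualP P, sz_dualN N]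
  | .lsub N P => by simp [PFm.dual, szP, szN, sz_dualP P, sz_dualN N]
  | .disj P Q => by simp [PFm.dual, szP, szN, sz_dualP P, sz_dualP Q]; omega
  | .down N => by simp [PFm.dual, szP, szN, sz_dualN N]
theorem sz_dualN : ∀ N : NFm, szP N.dual = szN N
  | .neg n => by simp [NFm.dual, szP, szN]
  | .par M N => by simp [NFm.dual, szP, szN, sz_dualN M, sz_dualN N]; omega
  | .ldiv Q M => by simp [NFm.dual, szP, szN, sz_dualN M, sz_dualP Q]
  | .rdiv M Q => by simp [NFm.dual, szP, szN, sz_dualN M, sz_dualP Q]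
  | .conj M N => by simp [NFm.dual, szP, szN, sz_dualN M, sz_dualN N]; omega
  | .up P => by simp [NFm.dual, szP, szN, sz_dualP P]
end

/-- all negative leaves satisfy `Q` -/
def Lv (Q : NFm → Prop) : FStr → Prop
  | .at _ => True
  | .nfm N => Q N
  | .stens a b => Lv Q a ∧ Lv Q b
  | .srsub a b => Lv Q a ∧ Lv Q b
  | .slsub a b => Lv Q a ∧ Lv Q b

theorem Lv.mono {Q R : NFm → Prop} (h : ∀ M, Q M → R M) : ∀ {a}, Lv Q a → Lv R a := by
  intro a
  induction a <;> simp only [Lv] <;> grind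

theorem tstar_sz {P π} (h : Tstar P π) : Lv (fun M => szN M < szP P) π := by
  induction h with
  | tens _ _ i1 i2 =>
    exact ⟨i1.mono (by intro M; simp only [szP]; omega), i2.mono (by intro M; simp only [szP]; omega)⟩
  | rsub _ _ i1 i2 =>
    rw [sz_dualN] at i2
    exact ⟨i1.mono (by intro M; simp only [szP]; omega), i2.mono (by intro M; simp only [szP]; omega)⟩
  | lsub _ _ i1 i2 =>
    rw [sz_dualN] at i2
    exact ⟨i2.mono (by intro M; simp only [szP]; omega), i1.mono (by intro M; simp only [szP]; omega)⟩
  | disjl _ i => exact i.mono (by intro M; simp only [szP]; omega)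
  | disjr _ i => exact i.mono (by intro M; simp only [szP]; omega)
  | down => simp [Lv, szP]
  | _ => trivial

mutual
def ssig0 : NFm → Set NFm
  | .up P => insert P.dual (ttau0 P)
  | .neg _ => ∅
  | .conj M N => ssig0 M ∪ ssig0 N
  | .par M N => ssig0 M ∪ ssig0 N
  | .rdiv M Q => ssig0 M ∪ ttau0 Q
  | .ldiv Q M => ssig0 M ∪ ttau0 Q
def ttau0 : PFm → Set NFm
  | .down N => insert N (ssig0 N)
  | .pos _ => ∅
  | .disj P Q => ttau0 P ∪ ttau0 Q
  | .tens P Q => ttau0 P ∪ ttau0 Q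
  | .lsub N P => ttau0 P ∪ ssig0 N
  | .rsub P N => ttau0 P ∪ ssig0 N
end

mutual
theorem s0_sub : ∀ (N : NFm) (M), M ∈ ssig0 N → Sum.inr M ∈ ssig N
  | .up P, M, h => by
      simp only [ssig0, ssig, Set.mem_insert_iff] at h ⊢
      exact h.imp (fun h => by rw [h]) (t0_sub P M)
  | .neg _, M, h => by simp [ssig0] at h
  | .conj A B, M, h => by
      simp only [ssig0, ssig, Set.mem_union] at h ⊢; exact h.imp (s0_sub A M) (s0_sub B M)
  | .par A B, M, h => by
      simp only [ssig0, ssig, Set.mem_union] at h ⊢; exact h.imp (s0_sub A M) (s0_sub B M)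
  | .rdiv A B, M, h => by
      simp only [ssig0, ssig, Set.mem_union] at h ⊢; exact h.imp (s0_sub A M) (t0_sub B M)
  | .ldiv B A, M, h => by
      simp only [ssig0, ssig, Set.mem_union] at h ⊢; exact h.imp (s0_sub A M) (t0_sub B M)
theorem t0_sub : ∀ (P : PFm) (M), M ∈ ttau0 P → Sum.inr M ∈ ttau P
  | .down N, M, h => by
      simp only [ttau0, ttau, Set.mem_insert_iff] at h ⊢
      exact h.imp (fun h => by rw [h]) (s0_sub N M)
  | .pos _, M, h => by simp [ttau0] at h
  | .disj A B, M, h => by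
      simp only [ttau0, ttau, Set.mem_union] at h ⊢; exact h.imp (t0_sub A M) (t0_sub B M)
  | .tens A B, M, h => by
      simp only [ttau0, ttau, Set.mem_union] at h ⊢; exact h.imp (t0_sub A M) (t0_sub B M)
  | .lsub B A, M, h => by
      simp only [ttau0, ttau, Set.mem_union] at h ⊢; exact h.imp (t0_sub A M) (s0_sub B M)
  | .rsub A B, M, h => by
      simp only [ttau0, ttau, Set.mem_union] at h ⊢; exact h.imp (t0_sub A M) (s0_sub B M)
end

mutual
theorem s0_dual : ∀ P : PFm, ssig0 P.dual = ttau0 P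
  | .pos n => by simp [PFm.dual, ssig0, ttau0]
  | .tens P Q => by simp [PFm.dual, ssig0, ttau0, s0_dual P, s0_dual Q, Set.union_comm]
  | .rsub P N => by simp [PFm.dual, ssig0, ttau0, s0_dual P, t0_dual N]
  | .lsub N P => by simp [PFm.dual, ssig0, ttau0, s0_dual P, t0_dual N]
  | .disj P Q => by simp [PFm.dual, ssig0, ttau0, s0_dual P, s0_dual Q, Set.union_comm]
  | .down N => by simp [PFm.dual, ssig0, ttau0, t0_dual N, dualN]
theorem t0_dual : ∀ N : NFm, ttau0 N.dual = ssig0 N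
  | .neg n => by simp [NFm.dual, ssig0, ttau0]
  | .par M N => by simp [NFm.dual, ssig0, ttau0, t0_dual M, t0_dual N, Set.union_comm]
  | .ldiv Q M => by simp [NFm.dual, ssig0, ttau0, t0_dual M, s0_dual Q]
  | .rdiv M Q => by simp [NFm.dual, ssig0, ttau0, t0_dual M, s0_dual Q]
  | .conj M N => by simp [NFm.dual, ssig0, ttau0, t0_dual M, t0_dual N, Set.union_comm]
  | .up P => by simp [NFm.dual, ssig0, ttau0, s0_dual P]
end

mutual
theorem s0_trans : ∀ (N : NFm) (M), M ∈ ssig0 N → ssig0 M ⊆ ssig0 N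
  | .up P, M, h => by
      simp only [ssig0, Set.mem_insert_iff] at h ⊢
      rcases h with rfl | h
      · rw [s0_dual]; exact Set.subset_insert _ _
      · exact (t0_trans P M h).trans (Set.subset_insert _ _)
  | .neg _, M, h => by simp [ssig0] at h
  | .conj A B, M, h => by
      simp only [ssig0, Set.mem_union] at h ⊢
      exact h.elim (fun h => Set.subset_union_of_subset_left (s0_trans A M h) _)
        (fun h => Set.subset_union_of_subset_right (s0_trans B M h) _)
  | .par A B, M, h => by
      simp only [ssig0, Set.mem_union] at h ⊢
      exact h.elim (fun h => Set.subset_union_of_subset_left (s0_trans A M h) _)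
        (fun h => Set.subset_union_of_subset_right (s0_trans B M h) _)
  | .rdiv A B, M, h => by
      simp only [ssig0, Set.mem_union] at h ⊢
      exact h.elim (fun h => Set.subset_union_of_subset_left (s0_trans A M h) _)
        (fun h => Set.subset_union_of_subset_right (t0_trans B M h) _)
  | .ldiv B A, M, h => by
      simp only [ssig0, Set.mem_union] at h ⊢
      exact h.elim (fun h => Set.subset_union_of_subset_left (s0_trans A M h) _)
        (fun h => Set.subset_union_of_subset_right (t0_trans B M h) _)
theorem t0_trans : ∀ (P : PFm) (M), M ∈ ttau0 P → ssig0 M ⊆ ttau0 P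
  | .down N, M, h => by
      simp only [ttau0, Set.mem_insert_iff] at h ⊢
      rcases h with rfl | h
      · exact Set.subset_insert _ _
      · exact (s0_trans N M h).trans (Set.subset_insert _ _)
  | .pos _, M, h => by simp [ttau0] at h
  | .disj A B, M, h => by
      simp only [ttau0, Set.mem_union] at h ⊢
      exact h.elim (fun h => Set.subset_union_of_subset_left (t0_trans A M h) _)
        (fun h => Set.subset_union_of_subset_right (t0_trans B M h) _)
  | .tens A B, M, h => by
      simp only [ttau0, Set.mem_union] at h ⊢
      exact h.elim (fun h => Set.subset_union_of_subset_left (t0_trans A M h) _)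
        (fun h => Set.subset_union_of_subset_right (t0_trans B M h) _)
  | .lsub B A, M, h => by
      simp only [ttau0, Set.mem_union] at h ⊢
      exact h.elim (fun h => Set.subset_union_of_subset_left (t0_trans A M h) _)
        (fun h => Set.subset_union_of_subset_right (s0_trans B M h) _)
  | .rsub A B, M, h => by
      simp only [ttau0, Set.mem_union] at h ⊢
      exact h.elim (fun h => Set.subset_union_of_subset_left (t0_trans A M h) _)
        (fun h => Set.subset_union_of_subset_right (s0_trans B M h) _)
end

theorem tstar_t0 {P π} (h : Tstar P π) : Lv (fun M => M ∈ ttau0 P) π := by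
  induction h with
  | tens _ _ i1 i2 => exact ⟨i1.mono (fun M h => Or.inl h), i2.mono (fun M h => Or.inr h)⟩
  | rsub _ _ i1 i2 =>
    rw [t0_dual] at i2
    exact ⟨i1.mono (fun M h => Or.inl h), i2.mono (fun M h => Or.inr h)⟩
  | lsub _ _ i1 i2 =>
    rw [t0_dual] at i2
    exact ⟨i2.mono (fun M h => Or.inr h), i1.mono (fun M h => Or.inl h)⟩
  | disjl _ i => exact i.mono (fun M h => Or.inl h)
  | disjr _ i => exact i.mono (fun M h => Or.inr h)
  | down => exact Or.inl rfl
  | _ => trivial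

theorem lv_fill {Q x} : ∀ (c : FCtx) (υ : FStr), Lv Q (c.fill x) → Lv Q υ →
    Lv Q x ∧ Lv Q (c.div υ) := by
  intro c
  induction c with
  | hole => intro υ h1 h2; exact ⟨h1, h2⟩
  | tensL c s ih => intro υ h1 h2; exact ih _ h1.1 ⟨h1.2, h2⟩
  | tensR s c ih => intro υ h1 h2; exact ih _ h1.2 ⟨h2, h1.1⟩
  | rsubL c s ih => intro υ h1 h2; exact ih _ h1.1 ⟨h1.2, h2⟩
  | rsubR s c ih => intro υ h1 h2; exact ih _ h1.2 ⟨h2, h1.1⟩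
  | lsubL c s ih => intro υ h1 h2; exact ih _ h1.1 ⟨h1.2, h2⟩
  | lsubR s c ih => intro υ h1 h2; exact ih _ h1.2 ⟨h2, h1.1⟩

theorem restrict {X : Set NFm} {S : Set NFm} (h1 : ∀ M ∈ S, Sum.inr M ∈ Xtau X)
    (h2 : ∀ M ∈ S, ssig0 M ⊆ S) {a b} (h : FSeq Set.univ a b) :
    Lv (· ∈ S) a → Lv (· ∈ S) b → FSeq X a b := by
  have key : ∀ {N σ}, N ∈ S → Tstar N.dual σ → Lv (· ∈ S) σ := by
    intro N σ hN ht
    have := tstar_t0 ht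
    rw [t0_dual] at this
    exact this.mono (fun M hM => h2 N hN hM)
  refine FSeq.rec (X := Set.univ)
    (motive_1 := fun a b _ => Lv (· ∈ S) a → Lv (· ∈ S) b → FSeq X a b)
    (motive_2 := fun a b _ => Lv (· ∈ S) a → Lv (· ∈ S) b → FFoc X a b)
    ?_ ?_ ?_ ?_ ?_ ?_ ?_ h
  · intro N σ' c υ _ ht _ ih ha hb
    have := lv_fill c υ ha hb
    exact .decL c υ (h1 N this.1) ht (ih this.2 (key this.1 ht))
  · intro N σ' c υ _ ht _ ih hb ha
    have := lv_fill c υ ha hb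
    exact .decR c υ (h1 N this.1) ht (ih this.2 (key this.1 ht))
  · intro n _ _; exact .id
  · intro π N _ ih ha hb
    exact .react (fun σ hs => ih σ hs ha (key hb hs))
  · intro _ _ _ _ _ _ i1 i2 ha hb; exact .tens (i1 ha.1 hb.1) (i2 ha.2 hb.2)
  · intro _ _ _ _ _ _ i1 i2 ha hb; exact .rsub (i1 ha.2 hb.2) (i2 ha.1 hb.1)
  · intro _ _ _ _ _ _ i1 i2 ha hb; exact .lsub (i1 ha.1 hb.1) (i2 ha.2 hb.2)

/-! Focused calculus with `X = univ`. -/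

abbrev S := FSeq Set.univ
abbrev F := FFoc Set.univ

theorem mem_univ_tau (N : NFm) : Sum.inr N ∈ Xtau Set.univ :=
  ⟨N, trivial, by simp [ttau]⟩

theorem dL {N σ'} (c : FCtx) (υ : FStr) (h : Tstar N.dual σ') (f : F (c.div υ) σ') :
    S (c.fill (.nfm N)) υ := .decL c υ (mem_univ_tau N) h f
theorem dR {N σ'} (c : FCtx) (υ : FStr) (h : Tstar N.dual σ') (f : F (c.div υ) σ') :
    S υ (c.fill (.nfm N)) := .decR c υ (mem_univ_tau N) h f

theorem sym {a b} (h : S a b) : S b a := by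
  cases h with
  | decL c _ _ h f => exact dR c _ h f
  | decR c _ _ h f => exact dL c _ h f

/-- Inversion of `S`: some decision on the left or the right. -/
theorem inv {a b} (h : S a b) : ∃ N σ' c, Tstar (NFm.dual N) σ' ∧
    ((a = FCtx.fill c (.nfm N) ∧ F (c.div b) σ') ∨ (b = FCtx.fill c (.nfm N) ∧ F (c.div a) σ')) := by
  cases h with
  | decL c _ _ h f => exact ⟨_, _, c, h, .inl ⟨rfl, f⟩⟩
  | decR c _ _ h f => exact ⟨_, _, c, h, .inr ⟨rfl, f⟩⟩

theorem dp1 {a b t} (h : S (.stens a b) t) : S a (.slsub b t) := by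
  obtain ⟨N, σ', c, ht, ⟨e, f⟩ | ⟨e, f⟩⟩ := inv h
  · cases c <;> simp only [FCtx.fill, FStr.stens.injEq, reduceCtorEq] at e
    case tensL c s => obtain ⟨rfl, rfl⟩ := e; exact dL c _ ht f
    case tensR s c => obtain ⟨rfl, rfl⟩ := e; exact dR (.lsubL c t) _ ht f
  · subst e; exact dR (.lsubR b c) _ ht f

theorem dp1' {a b t} (h : S a (.slsub b t)) : S (.stens a b) t := by
  obtain ⟨N, σ', c, ht, ⟨e, f⟩ | ⟨e, f⟩⟩ := inv h
  · subst e; exact dL (.tensL c b) _ ht f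
  · cases c <;> simp only [FCtx.fill, FStr.slsub.injEq, reduceCtorEq] at e
    case lsubL c s => obtain ⟨rfl, rfl⟩ := e; exact dL (.tensR a c) _ ht f
    case lsubR s c => obtain ⟨rfl, rfl⟩ := e; exact dR c _ ht f

theorem dp2 {a b t} (h : S a (.stens b t)) : S (.srsub a b) t := by
  obtain ⟨N, σ', c, ht, ⟨e, f⟩ | ⟨e, f⟩⟩ := inv h
  · subst e; exact dL (.rsubL c b) _ ht f
  · cases c <;> simp only [FCtx.fill, FStr.stens.injEq, reduceCtorEq] at e
    case tensL c s => obtain ⟨rfl, rfl⟩ := e; exact dL (.rsubR a c) _ ht f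
    case tensR s c => obtain ⟨rfl, rfl⟩ := e; exact dR c _ ht f

theorem dp2' {a b t} (h : S (.srsub a b) t) : S a (.stens b t) := by
  obtain ⟨N, σ', c, ht, ⟨e, f⟩ | ⟨e, f⟩⟩ := inv h
  · cases c <;> simp only [FCtx.fill, FStr.srsub.injEq, reduceCtorEq] at e
    case rsubL c s => obtain ⟨rfl, rfl⟩ := e; exact dL c _ ht f
    case rsubR s c => obtain ⟨rfl, rfl⟩ := e; exact dR (.tensL c t) _ ht f
  · subst e; exact dR (.tensR b c) _ ht f

theorem undisplay {x} : ∀ (c : FCtx) (υ : FStr), S x (c.div υ) → S (c.fill x) υ := by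
  intro c
  induction c with
  | hole => intro υ h; exact h
  | tensL c s ih => intro υ h; exact dp1' (ih _ h)
  | tensR s c ih => intro υ h; exact sym (dp2' (sym (ih _ h)))
  | rsubL c s ih => intro υ h; exact dp2 (ih _ h)
  | rsubR s c ih => intro υ h; exact dp2 (sym (dp1' (ih _ h)))
  | lsubL c s ih => intro υ h; exact sym (dp1 (sym (dp2' (sym (ih _ h)))))
  | lsubR s c ih => intro υ h; exact sym (dp1 (sym (ih _ h)))

/-- Identity. -/
theorem ident_aux (n : Nat) : ∀ π, Lv (fun M => szN M < n) π → F π π := by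
  induction n using Nat.strong_induction_on with
  | _ n ih =>
    intro π
    induction π with
    | nfm N =>
      intro h
      refine .react (fun σ hs => ?_)
      have := tstar_sz hs
      rw [sz_dualN] at this
      exact dL .hole σ hs (ih _ h σ this)
    | stens a b i1 i2 => intro h; exact .tens (i1 h.1) (i2 h.2)
    | srsub a b i1 i2 => intro h; exact .rsub (i2 h.2) (i1 h.1)
    | slsub a b i1 i2 => intro h; exact .lsub (i1 h.1) (i2 h.2)
    | _ => intro _; exact .id

theorem ident {P π} (h : Tstar P π) : F π π := ident_aux _ π (tstar_sz h)

inductive Sub (N : NFm) (π : FStr) : FStr → FStr → Prop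
  | atm (n) : Sub N π (.at n) (.at n)
  | nfm (M) : Sub N π (.nfm M) (.nfm M)
  | repl : Sub N π (.nfm N) π
  | tens {a b a' b'} : Sub N π a a' → Sub N π b b' → Sub N π (.stens a b) (.stens a' b')
  | rsub {a b a' b'} : Sub N π a a' → Sub N π b b' → Sub N π (.srsub a b) (.srsub a' b')
  | lsub {a b a' b'} : Sub N π a a' → Sub N π b b' → Sub N π (.slsub a b) (.slsub a' b')

theorem Sub.rfl' {N π} (a) : Sub N π a a := by
  induction a with
  | nfm M => exact .nfm M
  | stens a b i1 i2 => exact .tens i1 i2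
  | srsub a b i1 i2 => exact .rsub i1 i2
  | slsub a b i1 i2 => exact .lsub i1 i2
  | _ => exact .atm _

theorem sub_fill {N π y} : ∀ (c : FCtx) (b : FStr), Sub N π (c.fill y) b →
    ∃ c' x, b = FCtx.fill c' x ∧ Sub N π y x ∧
      ∀ υ υ', Sub N π υ υ' → Sub N π (c.div υ) (c'.div υ') := by
  intro c
  induction c with
  | hole => intro b h; exact ⟨.hole, b, rfl, h, fun _ _ h => h⟩
  | tensL c s ih =>
    intro b h; cases h with
    | tens h1 h2 =>
      obtain ⟨c', x, rfl, hx, hd⟩ := ih _ h1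
      exact ⟨.tensL c' _, x, rfl, hx, fun _ _ h => hd _ _ (.lsub h2 h)⟩
  | tensR s c ih =>
    intro b h; cases h with
    | tens h1 h2 =>
      obtain ⟨c', x, rfl, hx, hd⟩ := ih _ h2
      exact ⟨.tensR _ c', x, rfl, hx, fun _ _ h => hd _ _ (.rsub h h1)⟩
  | rsubL c s ih =>
    intro b h; cases h with
    | rsub h1 h2 =>
      obtain ⟨c', x, rfl, hx, hd⟩ := ih _ h1
      exact ⟨.rsubL c' _, x, rfl, hx, fun _ _ h => hd _ _ (.tens h2 h)⟩
  | rsubR s c ih =>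
    intro b h; cases h with
    | rsub h1 h2 =>
      obtain ⟨c', x, rfl, hx, hd⟩ := ih _ h2
      exact ⟨.rsubR _ c', x, rfl, hx, fun _ _ h => hd _ _ (.lsub h h1)⟩
  | lsubL c s ih =>
    intro b h; cases h with
    | lsub h1 h2 =>
      obtain ⟨c', x, rfl, hx, hd⟩ := ih _ h1
      exact ⟨.lsubL c' _, x, rfl, hx, fun _ _ h => hd _ _ (.rsub h2 h)⟩
  | lsubR s c ih =>
    intro b h; cases h with
    | lsub h1 h2 =>
      obtain ⟨c', x, rfl, hx, hd⟩ := ih _ h2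
      exact ⟨.lsubR _ c', x, rfl, hx, fun _ _ h => hd _ _ (.tens h h1)⟩

def Adm (N : NFm) : Prop := ∀ π, (∀ ρ, Tstar N.dual ρ → S π ρ) → ∀ γ, S γ (.nfm N) → S γ π

theorem foc_cut (ρ : FStr) : Lv Adm ρ → ∀ θ π, F θ ρ → S π ρ → S π θ := by
  induction ρ with
  | nfm M =>
    intro h θ π f s
    cases f with
    | react f => exact h θ f π s
  | stens a b i1 i2 =>
    intro h θ π f s
    cases f with
    | tens f1 f2 =>
      have s1 := i2 h.2 _ _ f2 (dp2 s)
      exact sym (dp1' (sym (i1 h.1 _ _ f1 (sym (dp1 (sym (dp2' s1)))))))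
  | srsub a b i1 i2 =>
    intro h θ π f s
    cases f with
    | rsub f2 f1 =>
      have s1 := i1 h.1 _ _ f1 (sym (dp2' (sym s)))
      have s2 := i2 h.2 _ _ f2 (sym (dp1 s1))
      exact sym (dp2 (sym (dp1' (sym s2))))
  | slsub a b i1 i2 =>
    intro h θ π f s
    cases f with
    | lsub f1 f2 =>
      have s1 := i2 h.2 _ _ f2 (dp1' s)
      have s2 := i1 h.1 _ _ f1 (dp2 (sym s1))
      exact dp1 (sym (dp2' s2))
  | _ => intro _ θ π f s; cases f; exact s

theorem adm_step (N : NFm) (ih : ∀ ρ, Tstar N.dual ρ → Lv Adm ρ) : Adm N := by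
  intro π K γ h
  have main : ∀ a b, S a b → ∀ a' b', Sub N π a a' → Sub N π b b' → S a' b' := by
    intro a b h
    have dec : ∀ {M σ'} (c : FCtx) (υ : FStr), Tstar (NFm.dual M) σ' →
        (∀ a', Sub N π (c.div υ) a' → F a' σ') →
        ∀ a' b', Sub N π (c.fill (.nfm M)) a' → Sub N π υ b' → S a' b' := by
      intro M σ' c υ ht i a' b' ha hb
      obtain ⟨c', x, rfl, hx, hd⟩ := sub_fill c _ ha
      have f := i _ (hd _ _ hb)
      cases hx with
      | nfm => exact dL c' _ ht f
      | repl => exact undisplay c' _ (foc_cut _ (ih _ ht) _ _ f (K _ ht))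
    refine FSeq.rec (X := Set.univ)
      (motive_1 := fun a b _ => ∀ a' b', Sub N π a a' → Sub N π b b' → S a' b')
      (motive_2 := fun a b _ => ∀ a', Sub N π a a' → F a' b)
      ?_ ?_ ?_ ?_ ?_ ?_ ?_ h
    · intro M σ' c υ _ ht _ i a' b' ha hb
      exact dec c υ ht i a' b' ha hb
    · intro M σ' c υ _ ht _ i a' b' ha hb
      exact sym (dec c υ ht i b' a' hb ha)
    · intro n a' ha; cases ha; exact .id
    · intro p M _ i a' ha
      exact .react (fun σ hs => i σ hs a' σ ha (Sub.rfl' σ))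
    · intro _ _ _ _ _ _ i1 i2 a' ha
      cases ha with
      | tens h1 h2 => exact .tens (i1 _ h1) (i2 _ h2)
    · intro _ _ _ _ _ _ i1 i2 a' ha
      cases ha with
      | rsub h1 h2 => exact .rsub (i1 _ h2) (i2 _ h1)
    · intro _ _ _ _ _ _ i1 i2 a' ha
      cases ha with
      | lsub h1 h2 => exact .lsub (i1 _ h1) (i2 _ h2)
  exact main _ _ h _ _ (Sub.rfl' γ) .repl

theorem adm_aux (n : Nat) : ∀ N, szN N = n → Adm N := by
  induction n using Nat.strong_induction_on with
  | _ n ih =>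
    intro N hN
    refine adm_step N (fun ρ hρ => ?_)
    have := tstar_sz hρ
    rw [sz_dualN, hN] at this
    exact this.mono (fun M hM => ih _ hM M rfl)

theorem adm (N : NFm) : Adm N := adm_aux _ N rfl

/-- Either `A'` is `↓A''`, or `(A⊥)'` is `↓(A⊥)''`. -/
theorem dec_cases (A : Fm) : decP A = .down (decN A) ∨ decP A.dual = .down (decN A.dual) := by
  cases A <;> simp [decP, decN, Fm.dual]

theorem cut_half (A : Fm) (hA : decP A = .down (decN A)) {γ δ}
    (h1 : ∀ ρ, Tstar (decP A) ρ → S δ ρ) (h2 : ∀ ρ, Tstar (decP A.dual) ρ → S γ ρ) : S δ γ := by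
  refine adm (decN A) γ ?_ δ (h1 _ (hA ▸ .down))
  rw [(dec_dual A).2]; exact h2

theorem cut {A : Fm} {γ δ}
    (h1 : ∀ ρ, Tstar (decP A) ρ → S δ ρ) (h2 : ∀ ρ, Tstar (decP A.dual) ρ → S γ ρ) : S δ γ := by
  rcases dec_cases A with h | h
  · exact cut_half A h h1 h2
  · exact sym (cut_half A.dual h h2 (by rw [dualF]; exact h1))

theorem ax_half (A : Fm) (hA : decP A = .down (decN A)) {π σ}
    (h1 : Tstar (decP A) π) (h2 : Tstar (decP A.dual) σ) : S π σ := by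
  rw [hA] at h1
  cases h1
  refine dL .hole σ ?_ (ident h2)
  rw [(dec_dual A).2]; exact h2

theorem ax {A : Fm} {π σ}
    (h1 : Tstar (decP A) π) (h2 : Tstar (decP A.dual) σ) : S π σ := by
  rcases dec_cases A with h | h
  · exact ax_half A h h1 h2
  · exact sym (ax_half A.dual h h2 (by rw [dualF]; exact h1))

theorem main {g c Γ Δ} (h : DSeq g c Γ Δ) : g = false → c = false →
    ∀ π σ : FStr, Tstar (decS Γ).posF π → Tstar (decS Δ).posF σ → S π σ := by
  induction h with
  | ax => intro _ _ π σ h1 h2; exact ax h1 h2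
  | cut _ _ i1 i2 =>
    intro hg hc π σ h1 h2
    exact sym (cut (fun ρ h => i1 hg hc _ _ h2 h) (fun ρ h => i2 hg hc _ _ h1 h))
  | sym _ i => intro hg hc π σ h1 h2; exact sym (i hg hc _ _ h2 h1)
  | dp1 _ i =>
    intro hg hc π σ h1 h2
    cases h2 with
    | lsub a b => rw [(negF_dual _).2] at b; exact dp1 (i hg hc _ _ (.tens h1 b) a)
  | dp1' _ i =>
    intro hg hc π σ h1 h2
    cases h1 with
    | tens a b => exact dp1' (i hg hc _ _ a (.lsub h2 (by rw [(negF_dual _).2]; exact b)))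
  | dp2 _ i =>
    intro hg hc π σ h1 h2
    cases h1 with
    | rsub a b => rw [(negF_dual _).2] at b; exact dp2 (i hg hc _ _ a (.tens b h2))
  | dp2' _ i =>
    intro hg hc π σ h1 h2
    cases h2 with
    | tens a b => exact dp2' (i hg hc _ _ (.rsub h1 (by rw [(negF_dual _).2]; exact a)) b)
  | tensL _ i => intro hg hc π σ h1 h2; exact i hg hc _ _ h1 h2
  | lsubL _ i =>
    intro hg hc π σ h1 h2
    refine i hg hc _ _ h1 ?_
    simpa [decS, PStr.posF, PStr.negF, dec_dual, dualF, decP] using h2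
  | rsubL _ i =>
    intro hg hc π σ h1 h2
    refine i hg hc _ _ h1 ?_
    simpa [decS, PStr.posF, PStr.negF, dec_dual, dualF, decP] using h2
  | @parL g c Γ Δ A B _ _ i1 i2 =>
    intro hg hc π σ h1 h2
    cases h1 with
    | tens a b =>
    cases h2
    refine dp1' (cut (fun ρ h => i2 hg hc _ _ a h) (fun ρ h => sym (dp1 ?_)))
    refine sym (dp2' (sym ?_))
    refine cut (fun ρ' h' => i1 hg hc _ _ b h') (fun ρ' h' => dp2 (sym ?_))
    refine dR (N := .par (decN A) (decN B)) .hole _ (.tens ?_ ?_) (.tens (ident h) (ident h'))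
    · rw [(dec_dual B).2]; exact h
    · rw [(dec_dual A).2]; exact h'
  | @rdivL g c Γ Δ A B _ _ i1 i2 =>
    intro hg hc π σ h1 h2
    cases h1 with
    | lsub a b =>
    rw [(negF_dual _).2] at b
    cases h2
    refine sym (dp1 (sym (cut (fun ρ h => i2 hg hc _ _ a h) (fun ρ h => sym (dp2' (sym ?_))))))
    refine cut (fun ρ' h' => i1 hg hc _ _ b h') (fun ρ' h' => dp2 (sym (dp1' ?_)))
    refine dL (N := .rdiv (decN A) (decP B)) .hole _ (.lsub ?_ ?_) (.lsub (ident h') (ident h))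
    · rw [(dec_dual A).2]; exact h
    · rw [dualP]; rw [dualF] at h'; exact h'
  | @ldivL g c Γ Δ A B _ _ i1 i2 =>
    intro hg hc π σ h1 h2
    cases h1 with
    | rsub a b =>
    rw [(negF_dual _).2] at b
    cases h2
    refine dp2 (cut (fun ρ h => i2 hg hc _ _ a h) (fun ρ h => dp1' ?_))
    refine cut (fun ρ' h' => i1 hg hc _ _ b h') (fun ρ' h' => sym (dp1 (sym (dp2' ?_))))
    refine dR (N := .ldiv (decP B) (decN A)) .hole _ (.rsub ?_ ?_) (.rsub (ident h') (ident h))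
    · rw [(dec_dual A).2]; exact h
    · rw [dualP]; rw [dualF] at h'; exact h'
  | @conjL1 g c Γ A B _ i =>
    intro hg hc π σ h1 h2
    cases h2
    refine cut (fun ρ h => i hg hc _ _ h1 h) (fun ρ h => dL (N := .conj (decN A) (decN B)) .hole ρ (.disjr ?_) (ident h))
    change Tstar (decN A).dual ρ
    rw [(dec_dual A).2]; exact h
  | @conjL2 g c Γ A B _ i =>
    intro hg hc π σ h1 h2
    cases h2
    refine cut (fun ρ h => i hg hc _ _ h1 h) (fun ρ h => dL (N := .conj (decN A) (decN B)) .hole ρ (.disjl ?_) (ident h))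
    change Tstar (decN B).dual ρ
    rw [(dec_dual B).2]; exact h
  | disjL _ _ i1 i2 =>
    intro hg hc π σ h1 h2
    cases h2 with
    | disjl h => exact i1 hg hc _ _ h1 h
    | disjr h => exact i2 hg hc _ _ h1 h
  | gr1 => intro hg; cases hg
  | gr2 => intro hg; cases hg
  | gr3 => intro hg; cases hg
  | cnl1 => intro _ hc; cases hc
  | cnl1' => intro _ hc; cases hc
  | cnl2 => intro _ hc; cases hc
  | cnl2' => intro _ hc; cases hc

end FocProof

/-- Theorem 3.27: if the presentation `Γ,Δ ⊢` is derivable in the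
unpolarized sequent calculus for LG∅, then for every π ∈ τ*(⌊Γ⌋⁺) and σ ∈ τ*(⌊Δ⌋⁺),
the focused presentation `π,σ ⊢` is derivable, with the parameter set X instantiated
to {⌊Γ⌋⁻, ⌊Δ⌋⁻}. -/
theorem unpolarized_to_focused (Γ Δ : Str) (h : DSeq false false Γ Δ) :
    ∀ π σ : FStr, Tstar (decS Γ).posF π → Tstar (decS Δ).posF σ →
      FSeq {(decS Γ).negF, (decS Δ).negF} π σ := by
  intro π σ h1 h2
  have l1 := FocProof.tstar_t0 h1
  have l2 := FocProof.tstar_t0 h2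
  rw [← FocProof.s0_dual, (FocProof.negF_dual _).1] at l1 l2
  refine FocProof.restrict
    (S := FocProof.ssig0 (decS Γ).negF ∪ FocProof.ssig0 (decS Δ).negF) ?_ ?_
    (FocProof.main h rfl rfl π σ h1 h2)
    (l1.mono (fun M h => Or.inl h)) (l2.mono (fun M h => Or.inr h))
  · rintro M (h | h)
    · exact ⟨_, Or.inl rfl, Or.inr (FocProof.s0_sub _ _ h)⟩
    · exact ⟨_, Or.inr rfl, Or.inr (FocProof.s0_sub _ _ h)⟩
  · rintro M (h | h)
    · exact fun x hx => Or.inl (FocProof.s0_trans _ _ h hx)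
    · exact fun x hx => Or.inr (FocProof.s0_trans _ _ h hx)
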